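/- Let p ≥ 3 be a prime and let μ ∈ ℚ_p with ‖μ‖_p = 1. For each n ∈ ℕ with n ≠ 1 and B_n ≠ 0, set c_n = B_n/(n!·(1 − p^{n−1}μ)) ∈ ℚ_p (these denominators are nonzero since ‖μ‖_p = 1). Then for every real number s > 1/(p−1), the infimum over all such n of (v_p(c_n) + n·s), where v_p denotes the p-adic valuation on ℚ_p (normalized by v_p(p) = 1), equals min(1, 2s, (p−1)s − 1). -/

import Mathlib

theorem aux_bern (p : ℕ) [hpf : Fact p.Prime] (k : ℕ) (hk : 0 < k) :
    ∃ y : ℚ_[p], ‖y‖ ≤ 1 ∧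
      ((_root_.bernoulli (2 * k) : ℚ) : ℚ_[p]) =
        y - (if (p - 1) ∣ 2 * k then ((p : ℚ_[p]))⁻¹ else 0) := by
  obtain ⟨T, hT⟩ := Bernoulli.vonStaudt_clausen k
  set S := (Finset.range (2 * k + 2)).filter (fun q => q.Prime ∧ (q - 1) ∣ 2 * k) with hS
  have hB : ((_root_.bernoulli (2 * k) : ℚ) : ℚ_[p]) = (T : ℚ_[p]) - ∑ q ∈ S, ((q : ℚ_[p]))⁻¹ := by
    have h1 : _root_.bernoulli (2 * k) = (T : ℚ) - ∑ q ∈ S, ((q : ℚ))⁻¹ := by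
      rw [hT]; simp
    rw [h1]; push_cast; rfl
  have hsum : ‖∑ q ∈ S.erase p, ((q : ℚ_[p]))⁻¹‖ ≤ 1 := by
    apply IsUltrametricDist.norm_sum_le_of_forall_le_of_nonneg zero_le_one
    intro q hq
    rw [Finset.mem_erase, hS, Finset.mem_filter] at hq
    obtain ⟨hne, -, hqp, -⟩ := hq
    have : ‖(q : ℚ_[p])‖ = 1 := by
      rw [Padic.norm_natCast_eq_one_iff]
      exact (Nat.coprime_primes hpf.out hqp).2 (Ne.symm hne)
    rw [norm_inv, this, inv_one]
  refine ⟨(T : ℚ_[p]) - ∑ q ∈ S.erase p, ((q : ℚ_[p]))⁻¹, ?_, ?_⟩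
  · rw [sub_eq_add_neg]
    refine (Padic.nonarchimedean _ _).trans (max_le (Padic.norm_int_le_one T) ?_)
    rwa [norm_neg]
  · rw [hB]
    split_ifs with hd
    · have hmem : p ∈ S := by
        rw [hS, Finset.mem_filter]
        have := Nat.le_of_dvd (by omega) hd
        exact ⟨Finset.mem_range.2 (by omega), hpf.out, hd⟩
      rw [← Finset.add_sum_erase _ _ hmem]; ring
    · rw [Finset.erase_eq_of_notMem]
      · ring
      · intro h
        rw [hS, Finset.mem_filter] at h
        exact hd h.2.2

theorem aux_val_eq (p : ℕ) [hpf : Fact p.Prime] (x : ℚ_[p]) (m : ℤ)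
    (h : ‖x‖ = (p : ℝ) ^ (-m)) : x.valuation = m := by
  have hp1 : (1 : ℝ) < p := by exact_mod_cast hpf.out.one_lt
  have hx : x ≠ 0 := by
    rintro rfl
    rw [norm_zero] at h
    have : (0 : ℝ) < (p : ℝ) ^ (-m) := by positivity
    linarith
  rw [Padic.norm_eq_zpow_neg_valuation hx] at h
  have := zpow_right_injective₀ (by linarith) hp1.ne' h
  simpa using this

theorem aux_norm_sub (p : ℕ) [hpf : Fact p.Prime] (x y : ℚ_[p]) (h : ‖x‖ < ‖y‖) :
    ‖x - y‖ = ‖y‖ := by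
  rw [sub_eq_add_neg, Padic.add_eq_max_of_ne (by rw [norm_neg]; exact h.ne), norm_neg,
    max_eq_right h.le]

theorem aux_norm_den (p : ℕ) [hpf : Fact p.Prime] (μ : ℚ_[p]) (hμ : ‖μ‖ = 1) (n : ℕ)
    (hn : 2 ≤ n) : ‖1 - (p : ℚ_[p]) ^ ((n : ℤ) - 1) * μ‖ = 1 := by
  have hp1 : (1 : ℝ) < p := by exact_mod_cast hpf.out.one_lt
  have : ‖(p : ℚ_[p]) ^ ((n : ℤ) - 1) * μ‖ < ‖(1 : ℚ_[p])‖ := by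
    rw [norm_mul, hμ, mul_one, Padic.norm_p_zpow, norm_one]
    exact zpow_lt_one_of_neg₀ hp1 (by omega)
  rw [norm_sub_rev, aux_norm_sub _ _ _ this, norm_one]

theorem aux_val (p : ℕ) [hpf : Fact p.Prime] (μ : ℚ_[p]) (hμ : ‖μ‖ = 1) (n : ℕ)
    (hn : 2 ≤ n) (hB : _root_.bernoulli n ≠ 0) :
    (((_root_.bernoulli n : ℚ) : ℚ_[p]) /
      ((n.factorial : ℚ_[p]) * (1 - (p : ℚ_[p]) ^ ((n : ℤ) - 1) * μ))).valuation =
    ((_root_.bernoulli n : ℚ) : ℚ_[p]).valuation - (padicValNat p n.factorial : ℤ) := by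
  have h1 := aux_norm_den p μ hμ n hn
  have h0 : (1 - (p : ℚ_[p]) ^ ((n : ℤ) - 1) * μ) ≠ 0 := by
    intro h; rw [h] at h1; simp at h1
  have hv := aux_val_eq p _ 0 (by simpa using h1)
  have hf : (n.factorial : ℚ_[p]) ≠ 0 := by exact_mod_cast n.factorial_ne_zero
  rw [div_eq_mul_inv, Padic.valuation_mul (by exact_mod_cast hB) (inv_ne_zero (mul_ne_zero hf h0)),
    Padic.valuation_inv, Padic.valuation_mul hf h0, hv, Padic.valuation_natCast]
  ring

theorem aux_bern_val_dvd (p : ℕ) [hpf : Fact p.Prime] (k : ℕ) (hk : 0 < k)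
    (hd : (p - 1) ∣ 2 * k) :
    ((_root_.bernoulli (2 * k) : ℚ) : ℚ_[p]).valuation = -1 ∧ _root_.bernoulli (2 * k) ≠ 0 := by
  have hp1 : (1 : ℝ) < p := by exact_mod_cast hpf.out.one_lt
  obtain ⟨y, hy, h⟩ := aux_bern p k hk
  rw [if_pos hd] at h
  have hn : ‖((_root_.bernoulli (2 * k) : ℚ) : ℚ_[p])‖ = p := by
    have hpn : ‖((p : ℚ_[p]))⁻¹‖ = p := by simp
    rw [h, aux_norm_sub _ _ _ (by rw [hpn]; linarith), hpn]
  refine ⟨aux_val_eq p _ _ (by rw [hn]; simp), ?_⟩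
  intro h0
  rw [h0] at hn
  simp at hn
  linarith

theorem aux_bern_val_ndvd (p : ℕ) [hpf : Fact p.Prime] (k : ℕ) (hk : 0 < k)
    (hd : ¬ (p - 1) ∣ 2 * k) :
    0 ≤ ((_root_.bernoulli (2 * k) : ℚ) : ℚ_[p]).valuation := by
  obtain ⟨y, hy, h⟩ := aux_bern p k hk
  rw [if_neg hd, sub_zero] at h
  rw [h]
  exact (Padic.norm_le_one_iff_val_nonneg y).1 hy

theorem aux_val_zero (p : ℕ) [hpf : Fact p.Prime] (μ : ℚ_[p]) (hμ : ‖μ‖ = 1) :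
    (((_root_.bernoulli 0 : ℚ) : ℚ_[p]) /
      (((0 : ℕ).factorial : ℚ_[p]) * (1 - (p : ℚ_[p]) ^ (((0 : ℕ) : ℤ) - 1) * μ))).valuation = 1 := by
  have hp1 : (1 : ℝ) < p := by exact_mod_cast hpf.out.one_lt
  have hn : ‖(p : ℚ_[p]) ^ (((0 : ℕ) : ℤ) - 1) * μ‖ = p := by
    rw [norm_mul, hμ, mul_one, Padic.norm_p_zpow]; simp
  apply aux_val_eq
  rw [norm_div, norm_mul, aux_norm_sub _ _ _ (by rw [hn, norm_one]; exact hp1), hn]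
  simp

/-- For an odd prime `p`, `μ ∈ ℚ_p` with `‖μ‖ = 1`, and `cₙ = Bₙ/(n!(1 - p^{n-1}μ))`,
for every real `s > 1/(p-1)` the infimum of `v_p(cₙ) + n s` over the `n ≠ 1` with
`Bₙ ≠ 0` equals `min(1, 2s, (p-1)s - 1)`. -/
theorem gauss_valuation_of_a (p : ℕ) [Fact p.Prime] (hp : 3 ≤ p)
    (μ : ℚ_[p]) (hμ : ‖μ‖ = 1) (s : ℝ) (hs : 1 / ((p : ℝ) - 1) < s) :
    sInf {r : ℝ | ∃ n : ℕ, n ≠ 1 ∧ _root_.bernoulli n ≠ 0 ∧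
        r = ((((_root_.bernoulli n : ℚ) : ℚ_[p]) /
              ((n.factorial : ℚ_[p]) * (1 - (p : ℚ_[p]) ^ ((n : ℤ) - 1) * μ))).valuation : ℝ)
            + n * s} =
      min 1 (min (2 * s) (((p : ℝ) - 1) * s - 1)) := by
  have hpp : p.Prime := Fact.out
  have hp3 : (3 : ℝ) ≤ p := by exact_mod_cast hp
  have hs' : 1 < ((p : ℝ) - 1) * s := by
    rw [div_lt_iff₀ (by linarith)] at hs; linarith
  have hs0 : 0 < s := lt_trans (by apply one_div_pos.2; linarith) hs
  have hcast : ((p - 1 : ℕ) : ℝ) = (p : ℝ) - 1 := by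
    rw [Nat.cast_sub (by omega)]; simp
  obtain ⟨j, hj⟩ : ∃ j, p - 1 = 2 * j := by
    obtain ⟨j, hj⟩ := hpp.odd_of_ne_two (by omega)
    exact ⟨j, by omega⟩
  -- membership of the three values
  have hlast := aux_bern_val_dvd p j (by omega) (by rw [hj])
  have hfl : padicValNat p (p - 1).factorial = 0 := by
    apply padicValNat.eq_zero_of_not_dvd
    rw [hpp.dvd_factorial]; omega
  have hlb : ∀ r ∈ {r : ℝ | ∃ n : ℕ, n ≠ 1 ∧ _root_.bernoulli n ≠ 0 ∧
        r = ((((_root_.bernoulli n : ℚ) : ℚ_[p]) /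
              ((n.factorial : ℚ_[p]) * (1 - (p : ℚ_[p]) ^ ((n : ℤ) - 1) * μ))).valuation : ℝ)
            + n * s}, min 1 (min (2 * s) (((p : ℝ) - 1) * s - 1)) ≤ r := by
    rintro r ⟨n, hn1, hB, rfl⟩
    rcases Nat.eq_zero_or_pos n with rfl | hpos
    · rw [aux_val_zero p μ hμ]
      simp
    · have hn2 : 2 ≤ n := by omega
      rw [aux_val p μ hμ n hn2 hB]
      rcases Nat.even_or_odd' n with ⟨k, hk | hk⟩
      swap
      · exact absurd (bernoulli_eq_zero_of_odd ⟨k, hk⟩ (by omega)) hB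
      have hleg := sub_one_mul_padicValNat_factorial_lt_of_ne_zero p (n := n) (by omega)
      generalize padicValNat p n.factorial = v at hleg ⊢
      rw [Int.cast_sub, Int.cast_natCast]
      apply (min_le_right _ _).trans
      by_cases hd : (p - 1) ∣ n
      · apply (min_le_right _ _).trans
        rw [hk, (aux_bern_val_dvd p k (by omega) (hk ▸ hd)).1, ← hk]
        obtain ⟨m, rfl⟩ := hd
        have hvm : v + 1 ≤ m := Nat.lt_of_mul_lt_mul_left hleg
        have hvm' : (v : ℝ) + 1 ≤ m := by exact_mod_cast hvm
        have hm1 : (1 : ℝ) ≤ m := by exact_mod_cast (show 1 ≤ m by omega)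
        push_cast
        rw [hcast]
        nlinarith [mul_nonneg (sub_nonneg.2 hm1) (sub_nonneg.2 hs'.le)]
      · have hb : (0 : ℝ) ≤ (((_root_.bernoulli n : ℚ) : ℚ_[p]).valuation : ℝ) := by
          have := aux_bern_val_ndvd p k (by omega) (hk ▸ hd)
          rw [← hk] at this
          exact_mod_cast this
        rcases Nat.eq_zero_or_pos v with rfl | hv
        · apply (min_le_left _ _).trans
          have : (2 : ℝ) ≤ n := by exact_mod_cast hn2
          push_cast
          nlinarith
        · apply (min_le_right _ _).trans
          have hv1 : (1 : ℝ) ≤ v := by exact_mod_cast hv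
          have hl : ((p : ℝ) - 1) * v ≤ n := by
            rw [← hcast]; exact_mod_cast hleg.le
          nlinarith [mul_nonneg (sub_nonneg.2 hv1) (sub_nonneg.2 hs'.le),
            mul_le_mul_of_nonneg_right hl hs0.le]
  apply IsLeast.csInf_eq
  refine ⟨?_, hlb⟩
  have hmem3 : (∃ n : ℕ, n ≠ 1 ∧ _root_.bernoulli n ≠ 0 ∧
        ((p : ℝ) - 1) * s - 1 = ((((_root_.bernoulli n : ℚ) : ℚ_[p]) /
              ((n.factorial : ℚ_[p]) * (1 - (p : ℚ_[p]) ^ ((n : ℤ) - 1) * μ))).valuation : ℝ)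
            + n * s) := by
    refine ⟨p - 1, by omega, hj ▸ hlast.2, ?_⟩
    rw [aux_val p μ hμ (p - 1) (by omega) (hj ▸ hlast.2), hfl, hcast]
    rw [← hj] at hlast
    rw [hlast.1]
    push_cast
    ring
  rcases min_choice 1 (min (2 * s) (((p : ℝ) - 1) * s - 1)) with h | h
  · rw [h]
    refine ⟨0, by omega, by simp, ?_⟩
    rw [aux_val_zero p μ hμ]
    simp
  rw [h]
  by_cases hp5 : p = 3
  · rw [min_eq_right (by subst hp5; push_cast; linarith)]
    exact hmem3
  rcases min_choice (2 * s) (((p : ℝ) - 1) * s - 1) with h | h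
  · rw [h]
    have hb2 : _root_.bernoulli 2 ≠ 0 := by rw [bernoulli_two]; norm_num
    refine ⟨2, by omega, hb2, ?_⟩
    rw [aux_val p μ hμ 2 le_rfl hb2]
    have h2 : padicValNat p (Nat.factorial 2) = 0 := by
      apply padicValNat.eq_zero_of_not_dvd
      rw [hpp.dvd_factorial]; omega
    have h6 : padicValNat p 6 = 0 := by
      apply padicValNat.eq_zero_of_not_dvd
      intro h
      rw [show 6 = 2 * 3 from rfl, hpp.dvd_mul] at h
      rcases h with h | h <;> have := Nat.le_of_dvd (by norm_num) h <;> omega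
    have hb : ((_root_.bernoulli 2 : ℚ) : ℚ_[p]).valuation = 0 := by
      rw [bernoulli_two]
      have : (((6 : ℚ)⁻¹ : ℚ) : ℚ_[p]) = ((6 : ℕ) : ℚ_[p])⁻¹ := by push_cast; rfl
      rw [this, Padic.valuation_inv, Padic.valuation_natCast, h6]; simp
    rw [h2, hb]; simp
  · rw [h]; exact hmem3
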